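/- arXiv:1601.04504 — 11 statements merged into one kernel-verified Lean document; each statement's English description precedes it below -/
import Mathlib

section
/- For all natural numbers n ≥ 1 and d ≥ 1, every set S of permutations of {1,...,n} with locality d satisfies |S| ≤ n! / ⌈n/(d+1)⌉!. -/
/-- A set `S` of permutations of `Fin n` (viewed in one-line notation as the word
`(π 0, …, π (n-1))`) has locality `d` if for every position `i` there is a set `J`
of at most `d` other positions such that the value of any `π ∈ S` at position `i`
is determined by its values at the positions in `J`. -/
def PermLocality {n : ℕ} (S : Set (Equiv.Perm (Fin n))) (d : ℕ) : Prop :=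
  ∀ i : Fin n, ∃ J : Finset (Fin n), i ∉ J ∧ J.card ≤ d ∧
    ∀ π ∈ S, ∀ σ ∈ S, (∀ j ∈ J, π j = σ j) → π i = σ i

theorem greedy_aux {n d : ℕ} (S : Set (Equiv.Perm (Fin n))) (hS : PermLocality S d) (m : ℕ) :
    m * (d + 1) ≤ n + d → ∃ K B : Finset (Fin n), B ⊆ K ∧ K.card ≤ m * (d + 1) ∧
      B.card + m = K.card ∧
      ∀ π ∈ S, ∀ σ ∈ S, (∀ j ∈ B, π j = σ j) → ∀ j ∈ K, π j = σ j := by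
  induction m with
  | zero => intro _; exact ⟨∅, ∅, by simp⟩
  | succ m ih =>
    intro h
    rw [Nat.succ_mul] at h
    obtain ⟨K, B, hBK, hK, hc, hdet⟩ := ih (by omega)
    have hlt : K.card < Fintype.card (Fin n) := by rw [Fintype.card_fin]; omega
    obtain ⟨i, hi⟩ : ∃ i, i ∉ K := by
      by_contra hcon
      push Not at hcon
      have : K = Finset.univ := Finset.eq_univ_iff_forall.2 hcon
      rw [this, Finset.card_univ] at hlt
      omega
    obtain ⟨J, hiJ, hJ, hJdet⟩ := hS i
    have h1 : (J \ K).card ≤ d := (Finset.card_le_card Finset.sdiff_subset).trans hJ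
    have h2 : (K ∪ (J \ K)).card = K.card + (J \ K).card :=
      Finset.card_union_of_disjoint Finset.disjoint_sdiff
    have h3 : (B ∪ (J \ K)).card = B.card + (J \ K).card :=
      Finset.card_union_of_disjoint (Finset.disjoint_of_subset_left hBK Finset.disjoint_sdiff)
    have h4 : (insert i (K ∪ (J \ K))).card = (K ∪ (J \ K)).card + 1 :=
      Finset.card_insert_of_notMem (by simp [hi, hiJ])
    refine ⟨insert i (K ∪ (J \ K)), B ∪ (J \ K), ?_, ?_, ?_, ?_⟩
    · exact (Finset.union_subset_union_left hBK).trans (Finset.subset_insert _ _)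
    · rw [Nat.succ_mul]; omega
    · omega
    · intro π hπ σ hσ hag
      have hKag := hdet π hπ σ hσ (fun j hj => hag j (Finset.mem_union_left _ hj))
      have hJag : ∀ j ∈ J, π j = σ j := by
        intro j hj
        by_cases hjK : j ∈ K
        · exact hKag j hjK
        · exact hag j (Finset.mem_union_right _ (Finset.mem_sdiff.2 ⟨hj, hjK⟩))
      intro j hj
      rcases Finset.mem_insert.1 hj with rfl | hj
      · exact hJdet π hπ σ hσ hJag
      · rcases Finset.mem_union.1 hj with hj | hj
        · exact hKag j hj
        · exact hJag j (Finset.mem_sdiff.1 hj).1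

/-- Every set of permutations of `{1,…,n}` with locality `d` has size at most
`n! / ⌈n/(d+1)⌉!`.  (Here `(n + d) / (d + 1) = ⌈n/(d+1)⌉`.) -/
theorem upper_bound_locality (n d : ℕ) (hn : 1 ≤ n) (hd : 1 ≤ d)
    (S : Set (Equiv.Perm (Fin n))) (hS : PermLocality S d) :
    S.ncard ≤ Nat.factorial n / Nat.factorial ((n + d) / (d + 1)) := by
  obtain ⟨K, B, hBK, hK, hc, hdet⟩ := greedy_aux S hS ((n + d) / (d + 1)) (Nat.div_mul_le_self _ _)
  generalize (n + d) / (d + 1) = m at *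
  have hKn : K.card ≤ n := by simpa using Finset.card_le_univ K
  have hC : (B ∪ Kᶜ).card = n - m := by
    rw [Finset.card_union_of_disjoint
      (Finset.disjoint_of_subset_left hBK disjoint_compl_right), Finset.card_compl,
      Fintype.card_fin]
    omega
  let f : S → ({x // x ∈ B ∪ Kᶜ} ↪ Fin n) := fun π =>
    (Function.Embedding.subtype _).trans π.1.toEmbedding
  have hf : Function.Injective f := by
    intro π σ h
    have hag : ∀ j ∈ B ∪ Kᶜ, π.1 j = σ.1 j := fun j hj =>
      DFunLike.congr_fun h (⟨j, hj⟩ : {x // x ∈ B ∪ Kᶜ})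
    apply Subtype.ext
    apply Equiv.ext
    intro j
    by_cases hj : j ∈ K
    · exact hdet _ π.2 _ σ.2 (fun j hj => hag j (Finset.mem_union_left _ hj)) j hj
    · exact hag j (Finset.mem_union_right _ (Finset.mem_compl.2 hj))
  have := Nat.card_le_card_of_injective f hf
  rw [Nat.card_coe_set_eq, Nat.card_eq_fintype_card (α := _ ↪ _), Fintype.card_embedding_eq,
    Fintype.card_coe, hC, Fintype.card_fin, Nat.descFactorial_eq_div (Nat.sub_le _ _),
    Nat.sub_sub_self (by omega)] at this
  exact this
end

section
/- For every natural number n ≥ 1, every set S of permutations of {1,...,n} with locality 1 satisfies |S| ≤ n!!, where n!! denotes the product ∏_{i=0}^{⌈n/2⌉−1} (n − 2i). -/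
theorem aux_df_mono : ∀ k : ℕ, Nat.doubleFactorial k ≤ Nat.doubleFactorial (k + 1)
  | 0 => by simp
  | 1 => by decide
  | k + 2 => by
    rw [Nat.doubleFactorial_add_two, Nat.doubleFactorial_add_two (k + 1)]
    exact Nat.mul_le_mul (by omega) (aux_df_mono k)

theorem aux_df_prod : ∀ n : ℕ,
    ∏ i ∈ Finset.range ((n + 1) / 2), (n - 2 * i) = Nat.doubleFactorial n
  | 0 => by simp
  | 1 => by simp
  | n + 2 => by
    have h : (n + 2 + 1) / 2 = (n + 1) / 2 + 1 := by omega
    rw [h, Finset.prod_range_succ', Nat.doubleFactorial_add_two, ← aux_df_prod n, mul_comm]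
    congr 1
    apply Finset.prod_congr rfl
    intro i _
    omega

theorem aux_main {n : ℕ} (f : Fin n → Fin n) (hf : ∀ i, f i ≠ i)
    (S : Set (Equiv.Perm (Fin n)))
    (hS : ∀ i, ∀ π ∈ S, ∀ σ ∈ S, π (f i) = σ (f i) → π i = σ i) :
    ∀ (m : ℕ) (D : Finset (Fin n)) (T : Finset (Equiv.Perm (Fin n))),
      Dᶜ.card = m → (∀ π ∈ T, π ∈ S) →
      (∀ π ∈ T, ∀ σ ∈ T, ∀ i ∈ D, π i = σ i) → T.card ≤ Nat.doubleFactorial m := by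
  intro m
  induction m using Nat.strong_induction_on with
  | _ m ih =>
  intro D T hm hTS hD
  by_cases h0 : ∃ i, i ∉ D
  swap
  · push Not at h0
    have : T.card ≤ 1 := by
      rw [Finset.card_le_one]
      intro a ha b hb
      ext i
      rw [hD a ha b hb i (h0 i)]
    exact this.trans (Nat.doubleFactorial_pos m)
  by_cases h1 : ∃ i, i ∉ D ∧ f i ∈ D
  · obtain ⟨i, hi, hfi⟩ := h1
    have hc : (insert i D)ᶜ.card + 1 = m := by
      rw [← hm, Finset.compl_insert]
      exact Finset.card_erase_add_one (by simpa using hi)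
    obtain ⟨k, rfl⟩ : ∃ k, m = k + 1 := ⟨_, hc.symm⟩
    refine (ih k (by omega) (insert i D) T (by omega) hTS ?_).trans (aux_df_mono k)
    intro π hπ σ hσ j hj
    rcases Finset.mem_insert.1 hj with rfl | hj
    · exact hS j π (hTS π hπ) σ (hTS σ hσ) (hD π hπ σ hσ _ hfi)
    · exact hD π hπ σ hσ j hj
  · push Not at h1
    obtain ⟨i, hi⟩ := h0
    have hr := h1 i hi
    have hc : (insert i (insert (f i) D))ᶜ.card + 2 = m := by
      rw [← hm, Finset.compl_insert, Finset.compl_insert]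
      have e1 := Finset.card_erase_add_one (s := Dᶜ) (a := f i) (by simpa using hr)
      have e2 := Finset.card_erase_add_one (s := Dᶜ.erase (f i)) (a := i)
        (by simp [hi, (hf i).symm])
      omega
    obtain ⟨k, rfl⟩ : ∃ k, m = k + 2 := ⟨_, hc.symm⟩
    rcases T.eq_empty_or_nonempty with rfl | ⟨π₀, hπ₀⟩
    · simp
    rw [Nat.doubleFactorial_add_two]
    have key := Finset.card_le_mul_card_image_of_maps_to (s := T)
      (t := Dᶜ.image π₀) (f := fun π => π (f i)) ?_ (Nat.doubleFactorial k) ?_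
    · rw [Finset.card_image_of_injective _ π₀.injective, hm] at key
      rwa [mul_comm] at key
    · intro π hπ
      refine Finset.mem_image.2 ⟨π₀.symm (π (f i)), ?_, by simp⟩
      rw [Finset.mem_compl]
      intro hmem
      have := hD π hπ π₀ hπ₀ _ hmem
      rw [Equiv.apply_symm_apply] at this
      exact hr (π.injective this ▸ hmem)
    · intro v _
      refine ih k (by omega) (insert i (insert (f i) D)) _ (by omega) ?_ ?_
      · intro π hπ
        exact hTS π (Finset.mem_filter.1 hπ).1
      · intro π hπ σ hσ j hj
        obtain ⟨hπT, hπv⟩ := Finset.mem_filter.1 hπ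
        obtain ⟨hσT, hσv⟩ := Finset.mem_filter.1 hσ
        have e : π (f i) = σ (f i) := hπv.trans hσv.symm
        rcases Finset.mem_insert.1 hj with rfl | hj
        · exact hS j π (hTS π hπT) σ (hTS σ hσT) e
        rcases Finset.mem_insert.1 hj with rfl | hj
        · exact e
        · exact hD π hπT σ hσT j hj

/-- Every set of permutations of `{1,…,n}` with locality `1` has size at most
`n!! = ∏_{i=0}^{⌈n/2⌉-1} (n - 2i)`. -/
theorem upper_bound_locality_one (n : ℕ) (hn : 1 ≤ n)
    (S : Set (Equiv.Perm (Fin n))) (hS : PermLocality S 1) :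
    S.ncard ≤ ∏ i ∈ Finset.range ((n + 1) / 2), (n - 2 * i) := by
  classical
  rw [aux_df_prod]
  rcases Nat.lt_or_ge 1 n with h2 | h2
  · have hex : ∀ i : Fin n, ∃ j, j ≠ i ∧
        ∀ π ∈ S, ∀ σ ∈ S, π j = σ j → π i = σ i := by
      intro i
      obtain ⟨J, hiJ, hJ, h⟩ := hS i
      rcases J.eq_empty_or_nonempty with rfl | ⟨j, hj⟩
      · haveI : Nontrivial (Fin n) := Fin.nontrivial_iff_two_le.2 h2
        obtain ⟨j, hj⟩ := exists_ne i
        exact ⟨j, hj, fun π hπ σ hσ _ => h π hπ σ hσ (by simp)⟩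
      · refine ⟨j, fun e => hiJ (e ▸ hj), fun π hπ σ hσ e => h π hπ σ hσ ?_⟩
        intro j' hj'
        rw [Finset.card_le_one.1 hJ j' hj' j hj, e]
    choose f hf hfS using hex
    rw [Set.ncard_eq_toFinset_card']
    exact aux_main f hf S hfS n ∅ S.toFinset (by simp) (by simp) (by simp)
  · obtain rfl : n = 1 := by omega
    have : S.ncard ≤ 1 := Set.ncard_le_one_of_subsingleton S
    simpa using this
end

section
/- For natural numbers n ≥ 1 and d ≥ 1 such that d+1 divides n, there exists a set S of permutations of {1,...,n} with locality d such that |S| ≥ n! / n^{n/(d+1)}. -/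
/-- If `d + 1` divides `n`, there exists a set of permutations of `{1,…,n}` with
locality `d` of size at least `n! / n^(n/(d+1))`, stated multiplicatively as
`n! ≤ |S| · n^(n/(d+1))`. -/
theorem lower_bound_locality (n d : ℕ) (hn : 1 ≤ n) (hd : 1 ≤ d) (hdvd : (d + 1) ∣ n) :
    ∃ S : Set (Equiv.Perm (Fin n)), PermLocality S d ∧
      Nat.factorial n ≤ S.ncard * n ^ (n / (d + 1)) := by
  classical
  haveI : NeZero n := ⟨by omega⟩
  obtain ⟨k, hk⟩ := hdvd
  have hdiv : n / (d + 1) = k := by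
    rw [hk]; exact Nat.mul_div_cancel_left k (Nat.succ_pos d)
  rw [hdiv]
  let e : Fin n ≃ Fin (d + 1) × Fin k := (finCongr hk).trans finProdFinEquiv.symm
  let z : Fin n ≃ ZMod n := (ZMod.finEquiv n).toEquiv
  let f : Equiv.Perm (Fin n) → (Fin k → ZMod n) :=
    fun π b => ∑ a : Fin (d + 1), z (π (e.symm (a, b)))
  obtain ⟨y, -, hy⟩ := Finset.exists_max_image (Finset.univ : Finset (Fin k → ZMod n))
    (fun y => (Finset.univ.filter (fun π => f π = y)).card) ⟨0, Finset.mem_univ _⟩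
  refine ⟨{π | f π = y}, ?_, ?_⟩
  · intro i
    refine ⟨((Finset.univ.erase (e i).1).image (fun a => e.symm (a, (e i).2))), ?_, ?_, ?_⟩
    · intro h
      obtain ⟨a, ha, hai⟩ := Finset.mem_image.1 h
      apply (Finset.mem_erase.1 ha).1
      rw [← hai]; simp
    · refine Finset.card_image_le.trans ?_
      rw [Finset.card_erase_of_mem (Finset.mem_univ _)]
      simp
    · intro π hπ σ hσ h
      have h1 : f π (e i).2 = f σ (e i).2 := by
        rw [show f π = y from hπ, show f σ = y from hσ]
      simp only [f] at h1
      rw [← Finset.add_sum_erase _ _ (Finset.mem_univ (e i).1),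
        ← Finset.add_sum_erase _ (fun a => z (σ (e.symm (a, (e i).2))))
          (Finset.mem_univ (e i).1)] at h1
      have h2 : ∑ a ∈ Finset.univ.erase (e i).1, z (π (e.symm (a, (e i).2)))
          = ∑ a ∈ Finset.univ.erase (e i).1, z (σ (e.symm (a, (e i).2))) :=
        Finset.sum_congr rfl fun a ha => by rw [h _ (Finset.mem_image_of_mem _ ha)]
      rw [h2] at h1
      have h3 := z.injective (add_right_cancel h1)
      simpa using h3
  · have h := Finset.card_le_mul_card_image_of_maps_to
      (s := (Finset.univ : Finset (Equiv.Perm (Fin n)))) (t := Finset.univ) (f := f)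
      (fun _ _ => Finset.mem_univ _) _ hy
    have hc : ({π | f π = y} : Set (Equiv.Perm (Fin n))).ncard
        = (Finset.univ.filter (fun π => f π = y)).card := by
      rw [← Set.ncard_coe_finset]; simp
    rw [hc]
    simpa [Fintype.card_perm, ZMod.card] using h
end

section
/- Let Σ be a finite alphabet of size n ≥ 1 and let d ≥ 1. Every (possibly non-linear) code S ⊆ Σ^n with locality d satisfies |S| ≤ n^{⌊dn/(d+1)⌋}. -/
/-- A set `S` of words of length `n` over an alphabet `α` has locality `d` if for every
coordinate `i` there is a set `J` of at most `d` other coordinates such that the value of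
any `x ∈ S` at coordinate `i` is determined by its values on `J`. -/
def WordLocality {n : ℕ} {α : Type*} (S : Set (Fin n → α)) (d : ℕ) : Prop :=
  ∀ i : Fin n, ∃ J : Finset (Fin n), i ∉ J ∧ J.card ≤ d ∧
    ∀ x ∈ S, ∀ y ∈ S, (∀ j ∈ J, x j = y j) → x i = y i

theorem exists_det {n d : ℕ} {α : Type*} (S : Set (Fin n → α)) (hS : WordLocality S d) :
    ∀ m ≤ n, ∃ K C : Finset (Fin n), m ≤ C.card ∧ (d + 1) * K.card ≤ d * C.card ∧
      ∀ x ∈ S, ∀ y ∈ S, (∀ j ∈ K, x j = y j) → ∀ j ∈ C, x j = y j := by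
  intro m
  induction m with
  | zero => intro _; exact ⟨∅, ∅, by simp⟩
  | succ m ih =>
    intro hm
    obtain ⟨K, C, h1, h2, h3⟩ := ih (by omega)
    by_cases hC : m + 1 ≤ C.card
    · exact ⟨K, C, hC, h2, h3⟩
    have : ∃ i, i ∉ C := by
      by_contra! hall
      have : C = Finset.univ := Finset.eq_univ_iff_forall.2 hall
      rw [this, Finset.card_univ, Fintype.card_fin] at hC
      omega
    obtain ⟨i, hi⟩ := this
    obtain ⟨J, hiJ, hJ, hdet⟩ := hS i
    have hCc : (insert i (C ∪ (J \ C))).card = C.card + (J \ C).card + 1 := by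
      rw [Finset.card_insert_of_notMem (by simp [hi, hiJ]),
        Finset.card_union_of_disjoint Finset.disjoint_sdiff]
    have hKc := Finset.card_union_le K (J \ C)
    have ha : (J \ C).card ≤ d := (Finset.card_le_card Finset.sdiff_subset).trans hJ
    refine ⟨K ∪ (J \ C), insert i (C ∪ (J \ C)), by omega, ?_, ?_⟩
    · rw [hCc]
      nlinarith
    · intro x hx y hy hxy
      have hc := h3 x hx y hy (fun j hj => hxy j (Finset.mem_union_left _ hj))
      have hj' : ∀ j ∈ J, x j = y j := by
        intro j hj
        by_cases h : j ∈ C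
        · exact hc j h
        · exact hxy j (Finset.mem_union_right _ (Finset.mem_sdiff.2 ⟨hj, h⟩))
      intro j hj
      rcases Finset.mem_insert.1 hj with rfl | hj
      · exact hdet x hx y hy hj'
      · rcases Finset.mem_union.1 hj with hj | hj
        · exact hc j hj
        · exact hj' j (Finset.mem_sdiff.1 hj).1

/-- Every (possibly non-linear) code of length `n` over an alphabet of size `n` with
locality `d` has at most `n ^ ⌊d·n/(d+1)⌋` codewords. -/
theorem nonlinear_code_locality_bound (n d : ℕ) (hn : 1 ≤ n) (hd : 1 ≤ d)
    (Sigma : Type*) [Fintype Sigma] (hcard : Fintype.card Sigma = n)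
    (S : Set (Fin n → Sigma)) (hS : WordLocality S d) :
    S.ncard ≤ n ^ (d * n / (d + 1)) := by
  obtain ⟨K, C, h1, h2, h3⟩ := exists_det S hS n le_rfl
  have hC : C = Finset.univ := by
    rw [← Finset.card_eq_iff_eq_univ, Fintype.card_fin]
    exact le_antisymm (by simpa using Finset.card_le_univ C) h1
  subst hC
  have hK : K.card ≤ d * n / (d + 1) := by
    rw [Nat.le_div_iff_mul_le (by omega), mul_comm]
    simpa using h2
  refine le_trans ?_ (Nat.pow_le_pow_right hn hK)
  have hinj : Function.Injective (fun (x : S) (j : K) => x.1 j.1) := by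
    intro x y hxy
    apply Subtype.ext
    funext j
    exact h3 x.1 x.2 y.1 y.2 (fun j hj => congrFun hxy ⟨j, hj⟩) j (Finset.mem_univ j)
  have := Nat.card_le_card_of_injective _ hinj
  rw [Nat.card_coe_set_eq] at this
  simpa [hcard] using this
end

section
/- For every natural number n ≥ 2, the alternating group A_n, i.e., the set of all even permutations of {1,...,n}, is a set of permutations with locality n−2. -/
/-- For `n ≥ 2`, the alternating group (the set of even permutations of `{1,…,n}`)
has locality `n - 2`. -/
theorem alternating_group_locality (n : ℕ) (hn : 2 ≤ n) :
    PermLocality ((alternatingGroup (Fin n) : Subgroup (Equiv.Perm (Fin n))) :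
      Set (Equiv.Perm (Fin n))) (n - 2) := by
  intro i
  haveI : Nontrivial (Fin n) := Fin.nontrivial_iff_two_le.mpr hn
  obtain ⟨k, hk⟩ := exists_ne i
  refine ⟨({i, k} : Finset (Fin n))ᶜ, by simp, ?_, ?_⟩
  · rw [Finset.card_compl, Finset.card_pair hk.symm, Fintype.card_fin]
  intro π hπ σ hσ h
  by_contra hne
  have hτ : σ⁻¹ * π ∈ alternatingGroup (Fin n) :=
    mul_mem (inv_mem hσ) hπ
  rw [Equiv.Perm.mem_alternatingGroup] at hτ
  have hsub : (σ⁻¹ * π).support ⊆ {i, k} := by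
    intro j hj
    by_contra hj2
    have := h j (Finset.mem_compl.mpr hj2)
    rw [Equiv.Perm.mem_support, Equiv.Perm.mul_apply, this] at hj
    simp at hj
  have hle : (σ⁻¹ * π).support.card ≤ 2 :=
    (Finset.card_le_card hsub).trans Finset.card_le_two
  have hne1 : σ⁻¹ * π ≠ 1 := by
    intro h1
    apply hne
    rw [inv_mul_eq_one.mp h1]
  have h2 := Equiv.Perm.two_le_card_support_of_ne_one hne1
  have hs := (Equiv.Perm.card_support_eq_two.mp (le_antisymm hle h2)).sign_eq
  rw [hτ] at hs
  exact absurd hs (by decide)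
end

section
/- For every even natural number n ≥ 2, the maximum size of a set of permutations of {1,...,n} with locality 1 equals n!! = ∏_{i=0}^{n/2−1}(n−2i); that is, there exists a set S ⊆ S_n with locality 1 and |S| = n!!, and every set S ⊆ S_n with locality 1 satisfies |S| ≤ n!!. -/
theorem loc_prod (m : ℕ) : ∏ i ∈ Finset.range m, (2 * m - 2 * i) = 2 ^ m * m.factorial := by
  induction m with
  | zero => simp
  | succ k ih =>
    rw [Finset.prod_range_succ', Nat.factorial_succ]
    have : ∏ i ∈ Finset.range k, (2 * (k + 1) - 2 * (i + 1)) =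
        ∏ i ∈ Finset.range k, (2 * k - 2 * i) :=
      Finset.prod_congr rfl (fun i _ => by omega)
    rw [this, ih, pow_succ]
    simp only [mul_zero, Nat.sub_zero]
    ring

open Classical in
theorem loc_upper {n : ℕ} (f : Fin n → Fin n) (hf : ∀ i, f i ≠ i) (m : ℕ) :
    ∀ (T : Finset (Equiv.Perm (Fin n))) (A : Finset (Fin n)),
      (∀ i, ∀ π ∈ T, ∀ σ ∈ T, π (f i) = σ (f i) → π i = σ i) →
      (∀ i, i ∈ A ↔ ∀ π ∈ T, ∀ σ ∈ T, π i = σ i) →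
      n ≤ A.card + 2 * m → T.card ≤ 2 ^ m * m.factorial := by
  induction m with
  | zero =>
    intro T A _ hA hn
    have hu : A = Finset.univ := by
      apply Finset.eq_univ_of_card
      have := Finset.card_le_univ A
      simp at this ⊢
      omega
    have : T.card ≤ 1 := Finset.card_le_one.2 (fun π hπ σ hσ => by
      ext i
      rw [(hA i).1 (by simp [hu]) π hπ σ hσ])
    simpa using this
  | succ m ih =>
    intro T A hT hA hn
    by_cases hu : ∀ i, i ∈ A
    · have : T.card ≤ 1 := Finset.card_le_one.2 (fun π hπ σ hσ => by
        ext i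
        rw [(hA i).1 (hu i) π hπ σ hσ])
      exact this.trans (Nat.succ_le_of_lt (by positivity))
    push Not at hu
    obtain ⟨i, hi⟩ := hu
    have hr : f i ∉ A := fun h => hi ((hA i).2 (fun π hπ σ hσ =>
      hT i π hπ σ hσ ((hA (f i)).1 h π hπ σ hσ)))
    rcases T.eq_empty_or_nonempty with rfl | ⟨π0, h0⟩
    · simp
    have hmaps : ∀ π ∈ T, π (f i) ∈ (A.image π0)ᶜ := by
      intro π hπ
      simp only [Finset.mem_compl, Finset.mem_image, not_exists, not_and]
      intro a ha h
      rw [(hA a).1 ha π0 h0 π hπ] at h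
      exact hr (π.injective h ▸ ha)
    have hcard : ((A.image π0)ᶜ).card ≤ 2 * (m + 1) := by
      rw [Finset.card_compl, Finset.card_image_of_injective _ π0.injective]
      simp
      omega
    have hfib : ∀ v ∈ (A.image π0)ᶜ, (T.filter (fun π => π (f i) = v)).card
        ≤ 2 ^ m * m.factorial := by
      intro v _
      set T' := T.filter (fun π => π (f i) = v) with hT'
      refine ih T' (Finset.univ.filter (fun i => ∀ π ∈ T', ∀ σ ∈ T', π i = σ i)) ?_ ?_ ?_
      · intro j π hπ σ hσ
        exact hT j π (Finset.mem_filter.1 hπ).1 σ (Finset.mem_filter.1 hσ).1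
      · intro j; simp
      · have hfi : ∀ π ∈ T', ∀ σ ∈ T', π (f i) = σ (f i) := fun π hπ σ hσ =>
          (Finset.mem_filter.1 hπ).2.trans (Finset.mem_filter.1 hσ).2.symm
        have hsub : insert i (insert (f i) A) ⊆
            Finset.univ.filter (fun i => ∀ π ∈ T', ∀ σ ∈ T', π i = σ i) := by
          intro j hj
          rw [Finset.mem_filter]
          refine ⟨Finset.mem_univ _, ?_⟩
          intro π hπ σ hσ
          have h1 := (Finset.mem_filter.1 hπ).1
          have h2 := (Finset.mem_filter.1 hσ).1
          rcases Finset.mem_insert.1 hj with rfl | hj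
          · exact hT j π h1 σ h2 (hfi π hπ σ hσ)
          rcases Finset.mem_insert.1 hj with rfl | hj
          · exact hfi π hπ σ hσ
          · exact (hA j).1 hj π h1 σ h2
        have hc := Finset.card_le_card hsub
        rw [Finset.card_insert_of_notMem, Finset.card_insert_of_notMem hr] at hc
        · omega
        · rw [Finset.mem_insert, not_or]
          exact ⟨(hf i).symm, hi⟩
    rw [Finset.card_eq_sum_card_fiberwise hmaps]
    calc _ ≤ ∑ v ∈ (A.image π0)ᶜ, 2 ^ m * m.factorial := Finset.sum_le_sum hfib
      _ = ((A.image π0)ᶜ).card * (2 ^ m * m.factorial) := by simp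
      _ ≤ 2 * (m + 1) * (2 ^ m * m.factorial) := Nat.mul_le_mul_right _ hcard
      _ = _ := by rw [Nat.factorial_succ, pow_succ]; ring

/-- For every even `n ≥ 2`, the maximum size of a set of permutations of `{1,…,n}` with
locality `1` equals `n!! = ∏_{i=0}^{n/2-1} (n - 2i)`: such a set of this size exists,
and no larger one does. -/
theorem locality_one_max_size (n : ℕ) (hn : 2 ≤ n) (heven : Even n) :
    (∃ S : Set (Equiv.Perm (Fin n)), PermLocality S 1 ∧
        S.ncard = ∏ i ∈ Finset.range (n / 2), (n - 2 * i)) ∧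
      (∀ S : Set (Equiv.Perm (Fin n)), PermLocality S 1 →
        S.ncard ≤ ∏ i ∈ Finset.range (n / 2), (n - 2 * i)) := by
  classical
  obtain ⟨m, hm⟩ := heven
  have hprod : ∏ i ∈ Finset.range (n / 2), (n - 2 * i) = 2 ^ m * m.factorial := by
    have h1 : n / 2 = m := by omega
    have h2 : n = 2 * m := by omega
    rw [h1, h2, loc_prod]
  rw [hprod]
  constructor
  · obtain ⟨g, hg⟩ := (Equiv.Perm.exists_with_cycleType_iff (Fin n)
      (m := Multiset.replicate m 2)).2 ⟨by simp; omega, fun a ha => by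
        rw [Multiset.eq_of_mem_replicate ha]⟩
    have hsupp : g.support = Finset.univ := by
      apply Finset.eq_univ_of_card
      rw [← Equiv.Perm.sum_cycleType, hg]
      simp; omega
    refine ⟨(Subgroup.centralizer {g} : Subgroup (Equiv.Perm (Fin n))), ?_, ?_⟩
    · intro i
      refine ⟨{g⁻¹ i}, ?_, by simp, ?_⟩
      · rw [Finset.mem_singleton]
        intro h
        have : i ∈ g.support := by simp [hsupp]
        rw [Equiv.Perm.mem_support] at this
        apply this
        conv_lhs => rw [h]
        simp
      · intro π hπ σ hσ h
        have h := h (g⁻¹ i) (by simp)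
        have key : ∀ ρ ∈ (Subgroup.centralizer {g} : Subgroup (Equiv.Perm (Fin n))),
            ρ i = g (ρ (g⁻¹ i)) := by
          intro ρ hρ
          have := Subgroup.mem_centralizer_singleton_iff.1 hρ
          have h2 := congrArg (fun p : Equiv.Perm (Fin n) => p (g⁻¹ i)) this
          simp at h2
          first
            | exact h2
            | exact h2.symm
            | simpa using h2
        rw [key π hπ, key σ hσ, h]
    · have h := Equiv.Perm.nat_card_centralizer g
      rw [hg] at h
      rw [← Nat.card_coe_set_eq]
      refine h.trans ?_
      have h2 : n - m * 2 = 0 := by omega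
      have hm0 : m ≠ 0 := by omega
      simp [h2, Multiset.toFinset_replicate, hm0]
  · intro S hS
    have hex : ∀ i : Fin n, ∃ j, j ≠ i ∧ ∀ π ∈ S, ∀ σ ∈ S, π j = σ j → π i = σ i := by
      intro i
      obtain ⟨J, hiJ, hJ, h⟩ := hS i
      rcases J.eq_empty_or_nonempty with rfl | ⟨j, hj⟩
      · haveI : Nontrivial (Fin n) := Fin.nontrivial_iff_two_le.2 hn
        obtain ⟨j, hj⟩ := exists_ne i
        exact ⟨j, hj, fun π hπ σ hσ _ => h π hπ σ hσ (by simp)⟩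
      · refine ⟨j, fun e => hiJ (e ▸ hj), fun π hπ σ hσ e => h π hπ σ hσ ?_⟩
        intro k hk
        rw [Finset.card_le_one.1 hJ k hk j hj, e]
    choose f hf hfd using hex
    rw [Set.ncard_eq_toFinset_card']
    refine loc_upper f hf m S.toFinset
      (Finset.univ.filter (fun i => ∀ π ∈ S, ∀ σ ∈ S, π i = σ i)) ?_ ?_ ?_
    · intro i π hπ σ hσ
      exact hfd i π (by simpa using hπ) σ (by simpa using hσ)
    · intro i; simp
    · omega
end

section
/- Let q = 2^m for some m ≥ 1 and let F_q be the finite field with q elements. Then the number of polynomials p ∈ F_q[x] of degree at most 4 whose evaluation map x ↦ p(x) is a bijection of F_q (i.e., permutation polynomials of degree at most 4) is at least (q−1)·(2q + q(q²+2)/3). -/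
open Finset in
lemma aux_G {F : Type*} [Field F] [Fintype F] [DecidableEq F] (a : F) (ha : a ≠ 0)
    (h2 : (2 : F) = 0) :
    Fintype.card F ^ 2 + 2 ≤ 3 * #{p : F × F | ∀ x : F, x ≠ 0 → a * x ^ 3 + p.1 * x + p.2 ≠ 0} := by
  classical
  set q := Fintype.card F with hq
  set K : F × F → Finset F := fun p => {x : F | x ≠ 0 ∧ a * x ^ 3 + p.1 * x + p.2 = 0} with hK
  have hq1 : 2 ≤ q := Fintype.one_lt_card
  have hk3 : ∀ p, #(K p) ≤ 3 := by
    intro p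
    let P : Polynomial F := .C a * .X ^ 3 + .C 0 * .X ^ 2 + .C p.1 * .X + .C p.2
    have hd : P.natDegree = 3 := Polynomial.natDegree_cubic ha
    have h0 : P ≠ 0 := by
      intro h; rw [h] at hd; simp at hd
    have hs : K p ⊆ P.roots.toFinset := by
      intro x hx
      simp only [hK, mem_filter, mem_univ, true_and] at hx
      simp only [Multiset.mem_toFinset, Polynomial.mem_roots h0, Polynomial.IsRoot.def]
      simp [P, hx.2]
    calc #(K p) ≤ _ := card_le_card hs
      _ ≤ _ := Multiset.toFinset_card_le _
      _ ≤ _ := Polynomial.card_roots' _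
      _ = 3 := hd
  have hpt : ∀ p : F × F, 3 + (#(K p).offDiag : ℕ) ≤
      3 * (if ∀ x : F, x ≠ 0 → a * x ^ 3 + p.1 * x + p.2 ≠ 0 then 1 else 0) + 3 * #(K p) := by
    intro p
    have h := hk3 p
    rw [offDiag_card]
    by_cases hc : #(K p) = 0
    · rw [if_pos]
      · simp [hc]
      · intro x hx hx2
        rw [card_eq_zero] at hc
        have : x ∈ K p := by simp [hK, hx, hx2]
        simp [hc] at this
    · have : 1 ≤ #(K p) := Nat.pos_of_ne_zero hc
      generalize #(K p) = k at *
      interval_cases k <;> omega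
  have hsum := Finset.sum_le_sum (fun p (_ : p ∈ (univ : Finset (F × F))) => hpt p)
  simp only [sum_add_distrib, ← mul_sum, sum_const, smul_eq_mul, card_univ, Fintype.card_prod,
    ← hq] at hsum
  rw [← card_filter] at hsum
  have h1 : ∑ p, #(K p) ≤ q * (q - 1) := by
    rw [← card_sigma]
    have : q * (q - 1) = #((univ : Finset F) ×ˢ (univ.erase (0 : F))) := by
      rw [card_product, card_erase_of_mem (mem_univ _), card_univ]
    rw [this]
    refine card_le_card_of_injOn (fun s => (s.1.1, s.2)) ?_ ?_
    · rintro ⟨⟨b, c⟩, x⟩ h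
      simp [hK] at h
      simp [h.1]
    · rintro ⟨⟨b, c⟩, x⟩ h ⟨⟨b', c'⟩, x'⟩ h' he
      simp [hK] at h h' he
      obtain ⟨rfl, rfl⟩ := he
      have : c = c' := by linear_combination h.2 - h'.2
      subst this
      rfl
  have h3 : (q - 1) * (q - 2) ≤ ∑ p, #(K p).offDiag := by
    rw [← card_sigma]
    have : (q - 1) * (q - 2) = #(univ.erase (0 : F)).offDiag := by
      rw [offDiag_card, card_erase_of_mem (mem_univ _), card_univ, ← hq, ← Nat.mul_sub_one]
      rfl
    rw [this]
    -- b = a (r^2 + r s + s^2), c = a r s (r+s)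
    refine card_le_card_of_injOn
      (fun s => ⟨(a * (s.1 ^ 2 + s.1 * s.2 + s.2 ^ 2), a * (s.1 * s.2 * (s.1 + s.2))), s⟩) ?_ ?_
    · rintro ⟨r, s⟩ h
      simp at h
      simp only [coe_sigma, Set.mem_sigma_iff, mem_coe, mem_univ, true_and, mem_offDiag, hK,
        mem_filter]
      refine ⟨⟨h.1, ?_⟩, ⟨h.2.1, ?_⟩, h.2.2⟩
      · linear_combination (a * r ^ 3 + a * r ^ 2 * s + a * r * s ^ 2) * h2
      · linear_combination (a * s ^ 3 + a * r ^ 2 * s + a * r * s ^ 2) * h2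
    · intro s _ t _ h
      simp at h
      exact h.2
  generalize #{p : F × F | ∀ x : F, x ≠ 0 → a * x ^ 3 + p.1 * x + p.2 ≠ 0} = N at *
  obtain ⟨k, hk⟩ := Nat.exists_eq_add_of_le hq1
  rw [hk] at h1 h3 hsum ⊢
  have e1 : 2 + k - 1 = k + 1 := by omega
  have e2 : 2 + k - 2 = k := by omega
  rw [e1] at h1 h3
  rw [e2] at h3
  nlinarith

open Finset in
lemma aux_G0 {F : Type*} [Field F] [Fintype F] [DecidableEq F] :
    2 * (Fintype.card F - 1) ≤
      #{p : F × F | ∀ x : F, x ≠ 0 → 0 * x ^ 3 + p.1 * x + p.2 ≠ 0} := by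
  have : 2 * (Fintype.card F - 1) =
      #(((univ.erase (0 : F)) ×ˢ {0}) ∪ ({0} ×ˢ (univ.erase (0 : F)))) := by
    rw [card_union_of_disjoint]
    · simp [card_erase_of_mem, card_univ]; omega
    · rw [disjoint_left]
      rintro ⟨b, c⟩ h h'
      simp only [mem_product, mem_erase, mem_singleton, mem_univ, and_true] at h h'
      exact h.1 h'.1
  rw [this]
  apply card_le_card
  rintro ⟨b, c⟩ h
  simp only [mem_union, mem_product, mem_erase, mem_singleton, mem_univ, and_true] at h
  simp only [mem_filter, mem_univ, true_and]
  rcases h with ⟨h, rfl⟩ | ⟨rfl, h⟩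
  · intro x hx; simp [h, hx]
  · intro x hx; simp [h]

/-- Over a finite field `F` with `q = 2^m` elements, the number of permutation
polynomials of degree at most `4` (polynomials whose evaluation map is a bijection
of `F`) is at least `(q-1)·(2q + q(q²+2)/3)`. -/
theorem permutation_polynomials_count (m : ℕ) (hm : 1 ≤ m)
    (F : Type*) [Field F] [Fintype F] (hF : Fintype.card F = 2 ^ m) :
    (2 ^ m - 1) * (2 * 2 ^ m + 2 ^ m * ((2 ^ m) ^ 2 + 2) / 3) ≤
      Set.ncard {p : Polynomial F | p.natDegree ≤ 4 ∧
        Function.Bijective fun x => Polynomial.eval x p} := by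
  classical
  have h2 : (2 : F) = 0 := by
    have := Nat.cast_card_eq_zero F
    rw [hF] at this
    push_cast at this
    exact pow_eq_zero_iff (by omega) |>.1 this
  rw [← hF]
  set q := Fintype.card F with hq
  let G : F → Finset (F × F) := fun a =>
    {p : F × F | ∀ x : F, x ≠ 0 → a * x ^ 3 + p.1 * x + p.2 ≠ 0}
  let S : Finset ((Σ _ : F, F × F) × F) := (Finset.univ.sigma G) ×ˢ Finset.univ
  let f : ((Σ _ : F, F × F) × F) → Polynomial F := fun s =>
    .C s.1.1 * .X ^ 4 + .C s.1.2.1 * .X ^ 2 + .C s.1.2.2 * .X + .C s.2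
  have hfin : Set.Finite {p : Polynomial F | p.natDegree ≤ 4 ∧
        Function.Bijective fun x => Polynomial.eval x p} := by
    refine Set.Finite.of_injOn (f := fun p => fun i : Fin 5 => p.coeff i) (t := Set.univ)
      (fun _ _ => Set.mem_univ _) ?_ Set.finite_univ
    intro p hp p' hp' h
    ext n
    by_cases hn : n < 5
    · exact congrFun h ⟨n, hn⟩
    · rw [Polynomial.coeff_eq_zero_of_natDegree_lt, Polynomial.coeff_eq_zero_of_natDegree_lt]
      · have := hp'.1; omega
      · have := hp.1; omega
  have hle : S.card ≤ Set.ncard {p : Polynomial F | p.natDegree ≤ 4 ∧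
        Function.Bijective fun x => Polynomial.eval x p} := by
    rw [← Set.ncard_coe_finset]
    refine Set.ncard_le_ncard_of_injOn f ?_ ?_ hfin
    · rintro ⟨⟨a, b, c⟩, d⟩ hs
      simp [S, G] at hs
      refine ⟨?_, ?_⟩
      · simp only [f]
        compute_degree
      · rw [← Finite.injective_iff_bijective]
        intro x y hxy
        simp [f] at hxy
        by_contra hne
        have hz : x - y ≠ 0 := sub_ne_zero.2 hne
        refine hs _ hz ?_
        apply mul_left_cancel₀ hz
        linear_combination hxy - (a * (2*x^3*y - 3*x^2*y^2 + 2*x*y^3 - y^4) + b * (x*y - y^2)) * h2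
    · rintro ⟨⟨a, b, c⟩, d⟩ _ ⟨⟨a', b', c'⟩, d'⟩ _ h
      have h4 := congrArg (fun p => Polynomial.coeff p 4) h
      have h2 := congrArg (fun p => Polynomial.coeff p 2) h
      have h1 := congrArg (fun p => Polynomial.coeff p 1) h
      have h0 := congrArg (fun p => Polynomial.coeff p 0) h
      simp [f, Polynomial.coeff_X, Polynomial.coeff_C, Polynomial.coeff_X_pow] at h4 h2 h1 h0
      subst h4 h2 h1 h0
      rfl
  refine le_trans ?_ hle
  have hS : S.card = (∑ a, (G a).card) * q := by
    simp [S, Finset.card_product, Finset.card_sigma, hq]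
  have hsum : (q - 1) * (q ^ 2 + 2) ≤ 3 * ∑ a ∈ Finset.univ.erase (0 : F), (G a).card := by
    rw [Finset.mul_sum]
    have : (q - 1) * (q ^ 2 + 2) = ∑ a ∈ Finset.univ.erase (0 : F), (q ^ 2 + 2) := by
      rw [Finset.sum_const, Finset.card_erase_of_mem (Finset.mem_univ _), Finset.card_univ,
        smul_eq_mul]
    rw [this]
    exact Finset.sum_le_sum fun a ha => aux_G a (Finset.ne_of_mem_erase ha) h2
  have h0 : 2 * (q - 1) ≤ (G 0).card := aux_G0
  rw [hS, ← Finset.add_sum_erase _ _ (Finset.mem_univ (0 : F))]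
  generalize ∑ a ∈ Finset.univ.erase (0 : F), (G a).card = A at *
  generalize (G 0).card = B at *
  have hdiv : 3 * (q * (q ^ 2 + 2) / 3) ≤ q * (q ^ 2 + 2) := Nat.mul_div_le _ _
  generalize q * (q ^ 2 + 2) / 3 = D at *
  generalize q - 1 = r at *
  have i1 := Nat.mul_le_mul_left r hdiv
  have i2 := Nat.mul_le_mul_right q hsum
  have i3 := Nat.mul_le_mul_right q h0
  nlinarith
end

section
/- Let n = 2^m with n ≥ 8. Then there exists a set B of permutations of {1,...,n} with locality 6 such that |B| ≥ (n−6)!! · (n−1)·(2n + n(n²+2)/3), where (n−6)!! = ∏_{i=0}^{(n−6)/2−1}(n−6−2i). -/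
theorem prod_even_aux (j : ℕ) : (∏ i ∈ Finset.range j, (2 * j - 2 * i)) = 2 ^ j * j.factorial := by
  induction j with
  | zero => simp
  | succ j ih =>
    rw [Finset.prod_range_succ', Nat.factorial_succ, pow_succ]
    have : ∀ i ∈ Finset.range j, 2 * (j + 1) - 2 * (i + 1) = 2 * j - 2 * i := by
      intro i _; omega
    rw [Finset.prod_congr rfl this, ih]
    simp only [mul_zero, Nat.sub_zero]
    ring

theorem cycleType_aux {n : ℕ} (k : ℕ) (hk : n = 2 * k) (t : Equiv.Perm (Fin n))
    (h2 : t ^ 2 = 1) (hf : ∀ x, t x ≠ x) : t.cycleType = Multiset.replicate k 2 := by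
  have h1 : ∀ a ∈ t.cycleType, a = 2 := by
    intro a ha
    have h3 := Equiv.Perm.two_le_of_mem_cycleType ha
    have h4 := (Equiv.Perm.dvd_of_mem_cycleType ha).trans (orderOf_dvd_of_pow_eq_one h2)
    have := Nat.le_of_dvd (by norm_num) h4
    omega
  have hs := t.sum_cycleType
  have hu : t.support = Finset.univ := by
    ext x; simp [hf x]
  rw [hu, Finset.card_univ, Fintype.card_fin] at hs
  have h5 := Multiset.eq_replicate_card.2 h1
  rw [h5, Multiset.sum_replicate, smul_eq_mul] at hs
  rw [h5]
  congr 1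
  omega

theorem arith_aux (j : ℕ) (hj : 1 ≤ j) :
    2 * (2 * j + 6) + (2 * j + 6) * ((2 * j + 6) ^ 2 + 2) / 3 ≤
      8 * ((j + 3) * (j + 2) * (j + 1)) := by
  obtain ⟨i, rfl⟩ := Nat.exists_eq_add_of_le hj
  have : (2 * (1 + i) + 6) * ((2 * (1 + i) + 6) ^ 2 + 2) / 3 ≤
      8 * ((1 + i + 3) * (1 + i + 2) * (1 + i + 1)) - 2 * (2 * (1 + i) + 6) := by
    apply Nat.div_le_of_le_mul
    rw [Nat.mul_sub]
    apply Nat.le_sub_of_add_le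
    nlinarith [sq_nonneg i, Nat.zero_le (i^3), Nat.zero_le i]
  have h2 : 2 * (2 * (1 + i) + 6) ≤ 8 * ((1 + i + 3) * (1 + i + 2) * (1 + i + 1)) := by
    nlinarith [sq_nonneg i, Nat.zero_le (i^3), Nat.zero_le i]
  omega

theorem locality_six_construction (n m : ℕ) (hn : n = 2 ^ m) (h8 : 8 ≤ n) :
    ∃ B : Set (Equiv.Perm (Fin n)), PermLocality B 6 ∧
      (∏ i ∈ Finset.range ((n - 6) / 2), (n - 6 - 2 * i)) *
          ((n - 1) * (2 * n + n * (n ^ 2 + 2) / 3)) ≤ B.ncard := by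
  classical
  have hm : m ≠ 0 := by rintro rfl; simp at hn; omega
  obtain ⟨k, hk⟩ : ∃ k, n = 2 * k := by
    obtain ⟨l, rfl⟩ := Nat.exists_eq_succ_of_ne_zero hm
    exact ⟨2 ^ l, by rw [hn, Nat.succ_eq_add_one, pow_succ]; ring⟩
  obtain ⟨j, rfl⟩ : ∃ j, k = j + 3 := ⟨k - 3, by omega⟩
  let G := Fin m → ZMod 2
  have hG : Fintype.card G = n := by simp [G, hn]
  have hadd : ∀ c : G, c + c = 0 := by
    intro c; funext i; exact CharTwo.add_self_eq_zero _
  let e : Fin n ≃ G := (Fintype.equivFinOfCardEq hG).symm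
  let τ : G → Equiv.Perm (Fin n) := fun c => (e.trans (Equiv.addRight c)).trans e.symm
  have hτ : ∀ c x, τ c x = e.symm (e x + c) := fun c x => rfl
  have hτinj : ∀ c d x, τ c x = τ d x → c = d := by
    intro c d x h
    rw [hτ, hτ] at h
    exact add_left_cancel (e.symm.injective h)
  have hinv : ∀ c x, τ c (τ c x) = x := by
    intro c x; simp [hτ, add_assoc, hadd]
  have hct : ∀ c, c ≠ 0 → (τ c).cycleType = Multiset.replicate (j + 3) 2 := by
    intro c hc
    apply cycleType_aux _ hk
    · ext x; simp [pow_two, hinv]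
    · intro x hx
      apply hc
      apply hτinj c 0 x
      rw [hx]; simp [hτ]
  haveI : Nontrivial G := by
    rw [← Fintype.one_lt_card_iff_nontrivial, hG]; omega
  obtain ⟨c0, hc0⟩ := exists_ne (0 : G)
  have hg : ∀ c : {c : G // c ≠ 0}, ∃ g : Equiv.Perm (Fin n), g * τ c0 * g⁻¹ = τ c := by
    intro c
    rw [← isConj_iff, Equiv.Perm.isConj_iff_cycleType_eq, hct _ hc0, hct _ c.2]
  choose g hg using hg
  let F : {c : G // c ≠ 0} × Subgroup.centralizer {τ c0} → Equiv.Perm (Fin n) :=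
    fun p => g p.1 * p.2.1
  have hF : ∀ p, F p * τ c0 = τ p.1 * F p := by
    rintro ⟨c, z, hz⟩
    have hz' := Subgroup.mem_centralizer_singleton_iff.1 hz
    simp only [F]
    rw [← hg c, mul_assoc, hz']
    group
  have hF' : ∀ p x, F p (τ c0 x) = τ p.1 (F p x) := fun p x => by
    have := congrArg (fun f : Equiv.Perm (Fin n) => f x) (hF p)
    simpa using this
  have x0 : Fin n := ⟨0, by omega⟩
  have hFinj : Function.Injective F := by
    intro p q h
    have h1 : p.1 = q.1 := by
      apply Subtype.ext
      apply hτinj _ _ (F p x0)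
      rw [← hF', h, ← hF']
    rcases p with ⟨c, z⟩
    rcases q with ⟨d, w⟩
    obtain rfl : c = d := h1
    have : z = w := Subtype.ext (mul_left_cancel h)
    rw [this]
  refine ⟨Set.range F, ?_, ?_⟩
  · intro i
    obtain ⟨i', hi'⟩ : ∃ i', i' ∉ ({i, τ c0 i} : Finset (Fin n)) := by
      by_contra! hcon
      have h1 : (Finset.univ : Finset (Fin n)) ⊆ {i, τ c0 i} := fun x _ => hcon x
      have h2 := Finset.card_le_card h1
      have h3 : ({i, τ c0 i} : Finset (Fin n)).card ≤ 2 := Finset.card_le_two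
      rw [Finset.card_univ, Fintype.card_fin] at h2
      omega
    simp only [Finset.mem_insert, Finset.mem_singleton, not_or] at hi'
    refine ⟨{τ c0 i, i', τ c0 i'}, ?_, Finset.card_le_three.trans (by norm_num), ?_⟩
    · simp only [Finset.mem_insert, Finset.mem_singleton, not_or]
      refine ⟨fun h => ?_, fun h => hi'.1 h.symm, fun h => hi'.2 ?_⟩
      · apply hc0
        apply hτinj c0 0 i
        rw [← h]; simp [hτ]
      · rw [h, hinv]
    · rintro _ ⟨p, rfl⟩ _ ⟨q, rfl⟩ h
      have ha := h (τ c0 i) (by simp)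
      have hb := h i' (by simp)
      have hc := h (τ c0 i') (by simp)
      rw [hF', hF'] at ha hc
      rw [hb] at hc
      have := hτinj _ _ _ hc
      rw [this] at ha
      exact (τ q.1).injective ha
  · rw [← Set.image_univ, Set.ncard_image_of_injective _ hFinj, Set.ncard_univ, Nat.card_prod,
      Equiv.Perm.nat_card_centralizer, hct _ hc0]
    have h1 : Nat.card {c : G // c ≠ 0} = n - 1 := by
      rw [Nat.card_eq_fintype_card, Fintype.card_subtype_compl, hG]
      simp
    rw [h1]
    have h2 : (n - 6) / 2 = j := by omega
    have h3 : n - 6 = 2 * j := by omega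
    rw [h2, h3, prod_even_aux]
    have h4 : (Multiset.replicate (j + 3) 2).toFinset = {2} := by
      rw [Multiset.toFinset_replicate]; simp
    rw [h4]
    have h5 : Fintype.card (Fin n) - (Multiset.replicate (j + 3) 2).sum = 0 := by
      simp; omega
    rw [h5]
    simp only [Nat.factorial_zero, Multiset.prod_replicate, Finset.prod_singleton,
      Multiset.count_replicate_self, one_mul]
    have h6 := arith_aux j (by omega)
    have h7 : n = 2 * j + 6 := by omega
    rw [← h7] at h6
    calc _ ≤ 2 ^ j * j.factorial * ((n - 1) * (8 * ((j + 3) * (j + 2) * (j + 1)))) := by gcongr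
      _ = _ := by
        simp only [Nat.factorial_succ, pow_succ]
        ring
end

section
/- Let n be an even natural number and t ≥ 1 an integer. Let A_t be the set of all permutations σ of {1,...,n} such that for every i ∈ {1,...,n/2}, the positions of the values 2i−1 and 2i satisfy |σ^{−1}(2i−1) − σ^{−1}(2i)| ≤ t. Then A_t has locality 4t. -/
/-- `A t`: the set of permutations `σ` of `{1,…,n}` (`0`-indexed: symbols `0,…,n-1`,
with the pair `{2k, 2k+1}` playing the role of `{2i-1, 2i}`) such that the positions of
the two symbols of each pair are at distance at most `t`. -/
def At (n t : ℕ) : Set (Equiv.Perm (Fin n)) :=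
  {σ | ∀ k : ℕ, ∀ hk : 2 * k + 1 < n,
    |((σ.symm ⟨2 * k, by omega⟩ : Fin n).val : ℤ) -
      ((σ.symm ⟨2 * k + 1, hk⟩ : Fin n).val : ℤ)| ≤ (t : ℤ)}

lemma At_partner (n t : ℕ) (heven : Even n) (v : Fin n) :
    ∃ w : Fin n, w ≠ v ∧ ∀ σ ∈ At n t,
      |((σ.symm v).val : ℤ) - ((σ.symm w).val : ℤ)| ≤ (t : ℤ) := by
  obtain ⟨m, hm⟩ := heven
  obtain ⟨v, hv⟩ := v
  rcases Nat.even_or_odd' v with ⟨k, rfl | rfl⟩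
  · refine ⟨⟨2 * k + 1, by omega⟩, by simp, fun σ hσ => hσ k (by omega)⟩
  · refine ⟨⟨2 * k, by omega⟩, by simp, fun σ hσ => ?_⟩
    rw [abs_sub_comm]
    exact hσ k hv

/-- For even `n` and `t ≥ 1`, the set `A_t` of permutations in which the positions of
`2i-1` and `2i` differ by at most `t` for every `i` has locality `4t`. -/
theorem multipermutation_locality (n t : ℕ) (heven : Even n) (ht : 1 ≤ t) :
    PermLocality (At n t) (4 * t) := by
  intro i
  refine ⟨Finset.univ.filter (fun j : Fin n => j ≠ i ∧ |(j.val : ℤ) - i.val| ≤ 2 * t), by simp, ?_, ?_⟩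
  · have h1 : (Finset.univ.filter (fun j : Fin n => j ≠ i ∧ |(j.val : ℤ) - i.val| ≤ 2 * t)).card
        ≤ ((Finset.Icc (i.val - 2 * t) (i.val + 2 * t)).erase i.val).card := by
      apply Finset.card_le_card_of_injOn (fun j => j.val)
      · intro j hj
        simp only [Finset.coe_filter, Finset.mem_univ, true_and, Set.mem_setOf_eq, abs_le] at hj
        simp only [Finset.mem_coe, Finset.mem_erase, Finset.mem_Icc]
        refine ⟨fun h => hj.1 (Fin.ext h), by omega, by omega⟩
      · intro a _ b _ h
        exact Fin.ext h
    rw [Finset.card_erase_of_mem (by simp), Nat.card_Icc] at h1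
    omega
  · intro π hπ σ hσ h
    obtain ⟨w, hw, hp⟩ := At_partner n t heven (π i)
    have h1 := hp π hπ
    have h2 := hp σ hσ
    rw [Equiv.symm_apply_apply] at h1
    have hji : π.symm w ≠ i := fun e => hw (by rw [← e]; simp)
    have e1 : σ.symm w = π.symm w := by
      have := h (π.symm w) (by
        simp only [Finset.mem_filter, Finset.mem_univ, true_and]
        refine ⟨hji, ?_⟩
        rw [abs_le] at *
        omega)
      rw [Equiv.apply_symm_apply] at this
      rw [this, Equiv.symm_apply_apply, ← this]
    rw [e1] at h2
    by_contra hne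
    have hj : σ.symm (π i) ≠ i := fun e => hne (by rw [← Equiv.symm_apply_eq]; exact e)
    have := h (σ.symm (π i)) (by
        simp only [Finset.mem_filter, Finset.mem_univ, true_and]
        refine ⟨hj, ?_⟩
        rw [abs_le] at *
        omega)
    rw [Equiv.apply_symm_apply] at this
    exact hj (π.injective this)
end

section
/- Fix ε ∈ (0,1] and for each even n set t(n) = ⌈n^ε⌉ and let A_{t(n)} be the set of all permutations σ of {1,...,n} such that |σ^{−1}(2i−1) − σ^{−1}(2i)| ≤ t(n) for all i ∈ {1,...,n/2}. Then liminf over even n → ∞ of log|A_{t(n)}| / log(n!) is at least 1/2 + ε/2. -/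
open Filter

lemma card_local (m w : ℕ) (hw : 0 < w) :
    (w.factorial) ^ (m / w) ≤
      Nat.card {g : Equiv.Perm (Fin m) // ∀ j, (g j).val / w = j.val / w} := by
  classical
  let f : Fin m → Fin (m / w + 1) := fun j =>
    ⟨j.val / w, Nat.lt_succ_of_le (Nat.div_le_div_right j.2.le)⟩
  have h1 := DomMulAct.stabilizer_card f
  have h2 : Nat.card {g : Equiv.Perm (Fin m) // ∀ j, (g j).val / w = j.val / w}
      = Fintype.card {g : Equiv.Perm (Fin m) // f ∘ g = f} := by
    rw [Nat.card_eq_fintype_card]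
    apply Fintype.card_congr
    apply Equiv.subtypeEquivRight
    intro g
    simp [funext_iff, f]
  rw [h2, h1, Fin.prod_univ_castSucc]
  have h3 : ∀ i : Fin (m / w), w ≤ Fintype.card {a // f a = i.castSucc} := by
    intro i
    have hi : (i.val + 1) * w ≤ m :=
      (Nat.mul_le_mul_right w i.2).trans (Nat.div_mul_le_self m w)
    have hi' : w * i.val + w ≤ m := by linarith [hi, mul_comm w i.val]
    let φ : Fin w → {a // f a = i.castSucc} := fun r =>
      ⟨⟨w * i.val + r.val, by have := r.2; omega⟩, by
        apply Fin.ext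
        simp only [f, Fin.val_castSucc]
        rw [Nat.mul_add_div hw, Nat.div_eq_of_lt r.2, add_zero]⟩
    have hφ : Function.Injective φ := by
      intro r s h
      simp only [φ, Subtype.mk.injEq, Fin.mk.injEq] at h
      exact Fin.ext (by omega)
    simpa using Fintype.card_le_of_injective φ hφ
  calc w.factorial ^ (m / w) = ∏ i : Fin (m / w), w.factorial := by simp
    _ ≤ ∏ i : Fin (m / w), (Fintype.card {a // f a = i.castSucc}).factorial :=
        Finset.prod_le_prod' fun i _ => Nat.factorial_le (h3 i)
    _ ≤ _ := Nat.le_mul_of_pos_right _ (Nat.factorial_pos _)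

lemma card_At (m w t : ℕ) (hw : 0 < w) (ht : 2 * w ≤ t + 1) :
    m.factorial * (w.factorial) ^ (m / w) ≤ Nat.card (At (m * 2) t) := by
  classical
  refine (Nat.mul_le_mul_left _ (card_local m w hw)).trans ?_
  have hc : m.factorial = Nat.card (Equiv.Perm (Fin m)) := by
    simp [Nat.card_eq_fintype_card, Fintype.card_perm]
  rw [hc, ← Nat.card_prod]
  let G : Equiv.Perm (Fin m) → Equiv.Perm (Fin m) → Equiv.Perm (Fin (m * 2)) := fun a b =>
    (finProdFinEquiv.symm.trans
      ((Equiv.prodCongrLeft (fun i : Fin 2 => if i = 0 then a else b)).trans finProdFinEquiv)).symm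
  have hG0 : ∀ a b (k : ℕ) (hk : k < m), ((G a b).symm ⟨2 * k, by omega⟩).val = 2 * (a ⟨k, hk⟩).val := by
    intro a b k hk
    have : (⟨2 * k, by omega⟩ : Fin (m * 2)) = finProdFinEquiv (⟨k, hk⟩, (0 : Fin 2)) := by
      apply Fin.ext; simp [finProdFinEquiv]
    rw [this]
    simp only [G, Equiv.symm_symm, Equiv.trans_apply, Equiv.symm_apply_apply]
    simp [finProdFinEquiv]
  have hG1 : ∀ a b (k : ℕ) (hk : k < m),
      ((G a b).symm ⟨2 * k + 1, by omega⟩).val = 2 * (b ⟨k, hk⟩).val + 1 := by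
    intro a b k hk
    have : (⟨2 * k + 1, by omega⟩ : Fin (m * 2)) = finProdFinEquiv (⟨k, hk⟩, (1 : Fin 2)) := by
      apply Fin.ext; simp [finProdFinEquiv]; omega
    rw [this]
    simp only [G, Equiv.symm_symm, Equiv.trans_apply, Equiv.symm_apply_apply]
    simp [finProdFinEquiv]; omega
  let F : Equiv.Perm (Fin m) × {g : Equiv.Perm (Fin m) // ∀ j, (g j).val / w = j.val / w} →
      At (m * 2) t := fun p => ⟨G p.1 (p.1.trans p.2.1), by
    intro k hk
    have hk' : k < m := by omega
    rw [hG0 _ _ k hk', hG1 _ _ k hk']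
    have h := p.2.2 (p.1 ⟨k, hk'⟩)
    simp only [Equiv.trans_apply]
    generalize (p.2.1 (p.1 ⟨k, hk'⟩)).val = x at *
    generalize (p.1 ⟨k, hk'⟩).val = y at *
    have h1 := Nat.div_add_mod x w
    have h2 := Nat.div_add_mod y w
    rw [h] at h1
    have h3 := Nat.mod_lt x hw
    have h4 := Nat.mod_lt y hw
    generalize w * (y / w) = z at *
    rw [abs_le]; push_cast; omega⟩
  refine Nat.card_le_card_of_injective F ?_
  rintro ⟨a, b, hb⟩ ⟨c, d, hd⟩ h
  have h' : G a (a.trans b) = G c (c.trans d) := congrArg Subtype.val h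
  have hac : a = c := by
    ext k
    have h1 := hG0 a (a.trans b) k k.2
    rw [h', hG0 c _ k k.2] at h1
    simp only [Fin.eta] at h1; omega
  subst hac
  have hbd : b = d := by
    ext k
    have h1 := hG1 a (a.trans b) (a.symm k) (a.symm k).2
    rw [h', hG1 a _ _ (a.symm k).2] at h1
    simp at h1; rw [h1]
  subst hbd; rfl

lemma log_fact (k : ℕ) (hk : 0 < k) : k * (Real.log k - 1) ≤ Real.log k.factorial := by
  have h := Real.pow_div_factorial_le_exp (k : ℝ) (by positivity) k
  have h2 := Real.log_le_log (by positivity) h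
  rw [Real.log_exp, Real.log_div (by positivity) (by positivity), Real.log_pow] at h2
  linarith

lemma log_card (m w t : ℕ) (hm : 0 < m) (hw : 0 < w) (ht : 2 * w ≤ t + 1) (hw1 : 1 ≤ Real.log w) :
    (m : ℝ) * (Real.log m - 1) + ((m : ℝ) - w) * (Real.log w - 1) ≤
      Real.log (Nat.card (At (m * 2) t)) := by
  have h := card_At m w t hw ht
  have h' : ((m.factorial : ℝ) * (w.factorial : ℝ) ^ (m / w)) ≤ Nat.card (At (m * 2) t) := by
    exact_mod_cast h
  have h2 := Real.log_le_log (by positivity) h'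
  rw [Real.log_mul (by positivity) (by positivity), Real.log_pow] at h2
  have h3 := log_fact m hm
  have h4 := log_fact w hw
  have h5 : ((m : ℝ) - w) ≤ ((m / w : ℕ) : ℝ) * w := by
    have h6 := Nat.div_add_mod m w
    have h7 := Nat.mod_lt m hw
    have : m ≤ (m / w) * w + w := by rw [mul_comm (m/w)]; omega
    have h8 : (m : ℝ) ≤ ((m / w : ℕ) : ℝ) * w + w := by exact_mod_cast this
    linarith
  have h6 : ((m / w : ℕ) : ℝ) * (w * (Real.log w - 1)) ≤ ((m / w : ℕ) : ℝ) * Real.log w.factorial :=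
    mul_le_mul_of_nonneg_left h4 (by positivity)
  have h7 := mul_le_mul_of_nonneg_right h5 (sub_nonneg.2 hw1)
  linarith

lemma log_fact_le (n : ℕ) : Real.log n.factorial ≤ n * Real.log n := by
  rw [← Real.log_pow]
  apply Real.log_le_log (by positivity)
  exact_mod_cast Nat.factorial_le_pow n

open Topology in
lemma tend (e : ℝ) (he1 : e < 1) (c : ℝ) :
    Tendsto (fun n : ℕ => (1 / 2 : ℝ) * (1 - c / Real.log n)
      + (1 / 2 - (n : ℝ) ^ (e - 1)) * (e - c / Real.log n)) atTop (𝓝 (1 / 2 + e / 2)) := by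
  have h1 : Tendsto (fun n : ℕ => c / Real.log n) atTop (𝓝 0) :=
    Tendsto.div_atTop tendsto_const_nhds
      (Real.tendsto_log_atTop.comp tendsto_natCast_atTop_atTop)
  have h2 : Tendsto (fun n : ℕ => (n : ℝ) ^ (e - 1)) atTop (𝓝 0) := by
    have := (tendsto_rpow_neg_atTop (y := 1 - e) (by linarith)).comp
      (tendsto_natCast_atTop_atTop (R := ℝ))
    refine this.congr fun n => ?_
    simp
  have h3 := ((h1.const_sub 1).const_mul (1/2)).add ((h2.const_sub (1/2)).mul (h1.const_sub e))
  convert h3 using 2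
  ring

lemma main_bound (ε e : ℝ) (he0 : 0 < e) (hee : e < ε) (hε1 : ε ≤ 1) :
    ∀ᶠ n : ℕ in atTop, Even n → (1 / 2 : ℝ) * (1 - (Real.log 2 + 1) / Real.log n)
      + (1 / 2 - (n : ℝ) ^ (e - 1)) * (e - (Real.log 2 + 1) / Real.log n) ≤
      Real.log (Nat.card (At n ⌈(n : ℝ) ^ ε⌉₊)) / Real.log (Nat.factorial n) := by
  have t1 : ∀ᶠ n : ℕ in atTop, 2 ≤ (n : ℝ) ^ (ε - e) :=
    ((tendsto_rpow_atTop (sub_pos.2 hee)).comp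
      (tendsto_natCast_atTop_atTop (R := ℝ))).eventually_ge_atTop 2
  have t2 : ∀ᶠ n : ℕ in atTop, 2 * Real.exp 1 + 2 ≤ (n : ℝ) ^ e :=
    ((tendsto_rpow_atTop he0).comp
      (tendsto_natCast_atTop_atTop (R := ℝ))).eventually_ge_atTop _
  have t3 : ∀ᶠ n : ℕ in atTop, (n : ℝ) ^ (e - 1) ≤ 1 / 2 := by
    have := (tendsto_rpow_neg_atTop (y := 1 - e) (by linarith)).comp
      (tendsto_natCast_atTop_atTop (R := ℝ))
    have := this.eventually_le_const (u := 1 / 2) (by norm_num)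
    filter_upwards [this] with n hn
    simpa using hn
  filter_upwards [t1, t2, t3, eventually_ge_atTop 3] with n h1 h2 h3 hn hev
  have hn0 : (0 : ℝ) < n := by positivity
  have hn3 : (3 : ℝ) ≤ n := by exact_mod_cast hn
  have hlog : 0 < Real.log n := Real.log_pos (by linarith)
  set w := ⌊(n : ℝ) ^ e⌋₊ with hw
  have hwle : (w : ℝ) ≤ (n : ℝ) ^ e := Nat.floor_le (by positivity)
  have hwgt : (n : ℝ) ^ e < w + 1 := Nat.lt_floor_add_one _
  have hexp := Real.exp_pos 1
  have hwhalf : (n : ℝ) ^ e / 2 ≤ w := by linarith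
  have hwe : Real.exp 1 ≤ w := by linarith
  have hw0' : (0 : ℝ) < w := by linarith
  have hw0 : 0 < w := by exact_mod_cast hw0'
  have hlw1 : 1 ≤ Real.log w := (Real.le_log_iff_exp_le hw0').2 hwe
  have hlw : e * Real.log n - Real.log 2 ≤ Real.log w := by
    have := Real.log_le_log (by positivity) hwhalf
    rwa [Real.log_div (by positivity) (by norm_num), Real.log_rpow hn0] at this
  have ht : 2 * w ≤ ⌈(n : ℝ) ^ ε⌉₊ + 1 := by
    have ha : (n : ℝ) ^ ε = (n : ℝ) ^ (ε - e) * (n : ℝ) ^ e := by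
      rw [← Real.rpow_add hn0]; congr 1; ring
    have hb : 2 * (n : ℝ) ^ e ≤ (n : ℝ) ^ ε := by
      rw [ha]; exact mul_le_mul_of_nonneg_right h1 (by positivity)
    have hc : (2 * w : ℝ) ≤ ⌈(n : ℝ) ^ ε⌉₊ := by
      linarith [Nat.le_ceil ((n : ℝ) ^ ε)]
    have hd : 2 * w ≤ ⌈(n : ℝ) ^ ε⌉₊ := by exact_mod_cast hc
    omega
  obtain ⟨m, hm⟩ := hev
  have hm2 : n = m * 2 := by omega
  have key := log_card m w ⌈(n : ℝ) ^ ε⌉₊ (by omega) hw0 ht hlw1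
  rw [← hm2] at key
  have hmr : (m : ℝ) = n / 2 := by rw [hm2]; push_cast; ring
  have hlm : Real.log m = Real.log n - Real.log 2 := by
    rw [hmr, Real.log_div (by positivity) (by norm_num)]
  rw [hlm, hmr] at key
  have hpow : (n : ℝ) ^ e = n * (n : ℝ) ^ (e - 1) := by
    rw [Real.rpow_sub_one hn0.ne']; field_simp
  have hnum : ((n : ℝ) / 2) * (Real.log n - Real.log 2 - 1)
      + (n / 2 - n * (n : ℝ) ^ (e - 1)) * (e * Real.log n - Real.log 2 - 1) ≤
      Real.log (Nat.card (At n ⌈(n : ℝ) ^ ε⌉₊)) := by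
    refine le_trans ?_ key
    have hA : (0 : ℝ) ≤ n / 2 - n * (n : ℝ) ^ (e - 1) := by
      have := mul_le_mul_of_nonneg_left h3 hn0.le
      linarith
    have hB : (n / 2 - n * (n : ℝ) ^ (e - 1)) ≤ (n : ℝ) / 2 - w := by
      rw [← hpow]; linarith
    have hC : (n / 2 - n * (n : ℝ) ^ (e - 1)) * (e * Real.log n - Real.log 2 - 1) ≤
        (n / 2 - n * (n : ℝ) ^ (e - 1)) * (Real.log w - 1) :=
      mul_le_mul_of_nonneg_left (by linarith) hA
    have hD := mul_le_mul_of_nonneg_right hB (sub_nonneg.2 hlw1)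
    linarith
  have hfp : 0 < Real.log (n.factorial) := by
    apply Real.log_pos
    have : n ≤ n.factorial := Nat.self_le_factorial n
    have : (n : ℝ) ≤ n.factorial := by exact_mod_cast this
    linarith
  have hcn : 0 ≤ Real.log (Nat.card (At n ⌈(n : ℝ) ^ ε⌉₊)) := Real.log_natCast_nonneg _
  refine le_trans ?_ (div_le_div_of_nonneg_left hcn hfp (log_fact_le n))
  rw [le_div_iff₀ (by positivity)]
  refine le_trans (le_of_eq ?_) hnum
  field_simp
  ring

/-- For `ε ∈ (0,1]` and `t(n) = ⌈n^ε⌉`, the liminf over even `n → ∞` of the rate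
`log |A_{t(n)}| / log (n!)` is at least `1/2 + ε/2`. -/
theorem multipermutation_rate (ε : ℝ) (hε0 : 0 < ε) (hε1 : ε ≤ 1) :
    (1 / 2 + ε / 2 : ℝ) ≤
      Filter.liminf
        (fun n : ℕ =>
          Real.log (Nat.card (At n ⌈(n : ℝ) ^ ε⌉₊)) / Real.log (Nat.factorial n))
        (Filter.atTop ⊓ Filter.principal {n : ℕ | Even n}) := by
  have hne : (Filter.atTop ⊓ Filter.principal {n : ℕ | Even n}).NeBot := by
    rw [← Filter.frequently_mem_iff_neBot]
    rw [Filter.frequently_atTop]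
    intro a
    exact ⟨2 * a, by omega, by simp⟩
  have hcob : IsCoboundedUnder (· ≥ ·) (Filter.atTop ⊓ Filter.principal {n : ℕ | Even n})
      (fun n : ℕ =>
          Real.log (Nat.card (At n ⌈(n : ℝ) ^ ε⌉₊)) / Real.log (Nat.factorial n)) := by
    apply IsBoundedUnder.isCoboundedUnder_ge
    refine ⟨1, ?_⟩
    rw [Filter.eventually_map]
    refine Filter.Eventually.of_forall fun n => ?_
    refine div_le_one_of_le₀ ?_ (Real.log_natCast_nonneg _)
    have hle : Nat.card (At n ⌈(n : ℝ) ^ ε⌉₊) ≤ n.factorial := by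
      have := Nat.card_le_card_of_injective (Subtype.val : At n ⌈(n : ℝ) ^ ε⌉₊ → _)
        Subtype.val_injective
      simpa [Nat.card_eq_fintype_card, Fintype.card_perm] using this
    rcases Nat.eq_zero_or_pos (Nat.card (At n ⌈(n : ℝ) ^ ε⌉₊)) with h | h
    · rw [h]; simpa using Real.log_natCast_nonneg _
    · exact Real.log_le_log (by exact_mod_cast h) (by exact_mod_cast hle)
  refine le_of_forall_lt fun c hc => ?_
  obtain ⟨c', hcc', hc'⟩ := exists_between hc
  refine hcc'.trans_le ?_
  obtain ⟨e, he, hee⟩ := exists_between (max_lt hε0 (by linarith : 2 * c' - 1 < ε))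
  have he0 := (le_max_left _ _).trans_lt he
  have he1 := (le_max_right _ _).trans_lt he
  refine Filter.le_liminf_of_le hcob ?_
  rw [Filter.eventually_inf_principal]
  have ht := (tend e (by linarith) (Real.log 2 + 1)).eventually_const_le
    (show c' < 1 / 2 + e / 2 by linarith)
  filter_upwards [ht, main_bound ε e he0 hee hε1] with n h1 h2 h3
  exact h1.trans (h2 h3)
end

section
/- For every natural number n ≥ 2, the maximum size of a set of permutations of {1,...,n} with locality n−2 equals n!/2; that is, every set S ⊆ S_n with locality n−2 satisfies |S| ≤ n!/2, and the alternating group A_n is a set with locality n−2 of size n!/2. -/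
/-- For `n ≥ 2`, the maximum size of a set of permutations of `{1,…,n}` with locality
`n - 2` equals `n!/2`: every such set has size at most `n!/2`, and the alternating
group attains this with locality `n - 2`. -/
theorem locality_n_sub_two_max (n : ℕ) (hn : 2 ≤ n) :
    (∀ S : Set (Equiv.Perm (Fin n)), PermLocality S (n - 2) →
        S.ncard ≤ Nat.factorial n / 2) ∧
      PermLocality ((alternatingGroup (Fin n) : Subgroup (Equiv.Perm (Fin n))) :
        Set (Equiv.Perm (Fin n))) (n - 2) ∧
      Set.ncard ((alternatingGroup (Fin n) : Subgroup (Equiv.Perm (Fin n))) :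
        Set (Equiv.Perm (Fin n))) = Nat.factorial n / 2 := by
  classical
  have key : ∀ i : Fin n, ∃ k : Fin n, k ≠ i := by
    intro i
    haveI : Nontrivial (Fin n) := Fin.nontrivial_iff_two_le.mpr hn
    exact exists_ne i
  refine ⟨?_, ?_, ?_⟩
  · intro S hS
    obtain ⟨J, hiJ, hJ, h⟩ := hS ⟨0, by omega⟩
    generalize (⟨0, by omega⟩ : Fin n) = i at *
    obtain ⟨k, hk⟩ : ∃ k, k ∉ insert i J := by
      by_contra! hc
      have h1 : insert i J = Finset.univ := Finset.eq_univ_iff_forall.mpr hc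
      have h2 := Finset.card_insert_of_notMem hiJ
      rw [h1, Finset.card_univ, Fintype.card_fin] at h2
      omega
    simp only [Finset.mem_insert, not_or] at hk
    have hinj : Function.Injective (fun π : Equiv.Perm (Fin n) => π * Equiv.swap i k) :=
      mul_left_injective _
    have hd : Disjoint S ((fun π : Equiv.Perm (Fin n) => π * Equiv.swap i k) '' S) := by
      rw [Set.disjoint_left]
      rintro _ h1 ⟨π, h2, rfl⟩
      have h3 := h _ h1 π h2 (by
        intro j hj
        have ha : j ≠ i := by rintro rfl; exact hiJ hj
        have hb : j ≠ k := by rintro rfl; exact hk.2 hj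
        simp [Equiv.swap_apply_of_ne_of_ne ha hb])
      simp at h3
      exact hk.1 h3
    have h4 := Set.ncard_union_eq hd (Set.toFinite _) (Set.toFinite _)
    rw [Set.ncard_image_of_injective _ hinj] at h4
    have h5 := Set.ncard_le_card (S ∪ ((fun π : Equiv.Perm (Fin n) => π * Equiv.swap i k) '' S))
    rw [Nat.card_eq_fintype_card, Fintype.card_perm, Fintype.card_fin] at h5
    omega
  · intro i
    obtain ⟨k, hk⟩ := key i
    refine ⟨({i, k} : Finset (Fin n))ᶜ, by simp, ?_, ?_⟩
    · rw [Finset.card_compl, Finset.card_pair hk.symm, Fintype.card_fin]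
    · intro π hπ σ hσ hJ
      by_contra hne
      have hτ : Equiv.Perm.sign (σ⁻¹ * π) = 1 := by
        have h1 : Equiv.Perm.sign π = 1 := hπ
        have h2 : Equiv.Perm.sign σ = 1 := hσ
        simp [h1, h2]
      have hfix : ∀ j, j ≠ i → j ≠ k → (σ⁻¹ * π) j = j := by
        intro j h1 h2
        have := hJ j (by simp [h1, h2])
        simp [this]
      have hi : (σ⁻¹ * π) i ≠ i := by
        intro h
        apply hne
        rw [Equiv.Perm.mul_apply, Equiv.Perm.inv_eq_iff_eq] at h
        exact h
      generalize σ⁻¹ * π = τ at *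
      have hik : τ i = k := by
        by_contra h
        exact hi (τ.injective (hfix _ hi h))
      have hki : τ k = i := by
        by_contra h
        have hkk : τ k ≠ k := fun h' => hk (τ.injective (h'.trans hik.symm))
        exact hkk (τ.injective (hfix _ h hkk))
      have : τ = Equiv.swap i k := by
        ext j
        by_cases h1 : j = i
        · subst h1; simp [hik]
        by_cases h2 : j = k
        · subst h2; simp [hki]
        rw [hfix j h1 h2, Equiv.swap_apply_of_ne_of_ne h1 h2]
      rw [this, Equiv.Perm.sign_swap hk.symm] at hτ
      exact absurd hτ (by decide)
  · haveI : Nontrivial (Fin n) := Fin.nontrivial_iff_two_le.mpr hn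
    have h := two_mul_nat_card_alternatingGroup (α := Fin n)
    rw [Nat.card_perm, Nat.card_eq_fintype_card, Nat.card_eq_fintype_card, Fintype.card_fin] at h
    rw [← Nat.card_coe_set_eq, Nat.card_eq_fintype_card]
    have h' : Fintype.card (alternatingGroup (Fin n)) = Nat.factorial n / 2 := by omega
    rw [← h']
    exact Fintype.card_congr (Equiv.refl _)
end
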